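/- arXiv:1402.2520 — 5 statements merged into one kernel-verified Lean document; each statement's English description precedes it below -/
import Mathlib

section
/- Let n, m be positive integers and 1 ≤ k ≤ m. For all f, g ∈ C[0,1] and all x ∈ [(k-1)/m, k/m], the following Grüss-type inequality holds: |B̄_{n,m}(f·g; x) - B̄_{n,m}(f; x)·B̄_{n,m}(g; x)| ≤ (1/4)·ω̃(f; 2√((x-(k-1)/m)(k/m-x)/n))·ω̃(g; 2√((x-(k-1)/m)(k/m-x)/n)). -/
open Set Finset

noncomputable section

/-- First order modulus of continuity of `f` on `[a,b]`. -/
def omega1 (a b : ℝ) (f : ℝ → ℝ) (t : ℝ) : ℝ :=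
  sSup {v | ∃ x ∈ Set.Icc a b, ∃ y ∈ Set.Icc a b, |x - y| ≤ t ∧ v = |f x - f y|}

/-- Least concave majorant of the first order modulus of continuity on `[0,1]`. -/
def omegaTilde (f : ℝ → ℝ) (t : ℝ) : ℝ :=
  if t ≤ 1 then
    sSup {v | ∃ x y : ℝ, 0 ≤ x ∧ x ≤ t ∧ t ≤ y ∧ y ≤ 1 ∧ x ≠ y ∧
      v = ((t - x) * omega1 0 1 f y + (y - t) * omega1 0 1 f x) / (y - x)}
  else omega1 0 1 f 1

/-- The Bernstein polynomial of degree `n` associated to `f` on the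
subinterval `[(k-1)/m, k/m]`. -/
def bernsteinPiece (n m k : ℕ) (f : ℝ → ℝ) (x : ℝ) : ℝ :=
  (m : ℝ) ^ n * ∑ i ∈ Finset.range (n + 1),
    (n.choose i : ℝ) * (x - ((k : ℝ) - 1) / (m : ℝ)) ^ i * ((k : ℝ) / (m : ℝ) - x) ^ (n - i) *
      f (((k : ℝ) * n - n + i) / ((m : ℝ) * n))

/-- The index `k` (with `1 ≤ k ≤ m`) such that `x` belongs to the piece `[(k-1)/m, k/m]`. -/
def pieceIdx (m : ℕ) (x : ℝ) : ℕ := min m (⌊(m : ℝ) * x⌋.toNat + 1)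

/-- The composite Bernstein operator `B̄_{n,m}`. -/
def compBernstein (n m : ℕ) (f : ℝ → ℝ) : ℝ → ℝ := fun x =>
  bernsteinPiece n m (pieceIdx m x) f x

/-- The values `|f x - f y|` for `x, y ∈ [0,1]` are bounded when `f` is continuous. -/
lemma bddAbove_omega1_set {f : ℝ → ℝ} (hf : ContinuousOn f (Set.Icc 0 1)) (t : ℝ) :
    BddAbove {v | ∃ x ∈ Set.Icc (0 : ℝ) 1, ∃ y ∈ Set.Icc (0 : ℝ) 1,
      |x - y| ≤ t ∧ v = |f x - f y|} := by
  obtain ⟨M, hM⟩ := isCompact_Icc.exists_bound_of_continuousOn hf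
  refine ⟨M + M, ?_⟩
  rintro v ⟨x, hx, y, hy, -, rfl⟩
  exact (norm_sub_le (f x) (f y)).trans (add_le_add (hM x hx) (hM y hy))

lemma abs_sub_le_omega1 {f : ℝ → ℝ} (hf : ContinuousOn f (Set.Icc 0 1)) {x y t : ℝ}
    (hx : x ∈ Set.Icc (0 : ℝ) 1) (hy : y ∈ Set.Icc (0 : ℝ) 1) (h : |x - y| ≤ t) :
    |f x - f y| ≤ omega1 0 1 f t :=
  le_csSup (bddAbove_omega1_set hf t) ⟨x, hx, y, hy, h, rfl⟩

lemma omega1_nonneg (a b : ℝ) (f : ℝ → ℝ) (t : ℝ) : 0 ≤ omega1 a b f t := by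
  apply Real.sSup_nonneg
  rintro v ⟨x, -, y, -, -, rfl⟩
  exact abs_nonneg _

lemma omega1_mono {f : ℝ → ℝ} (hf : ContinuousOn f (Set.Icc 0 1)) {s t : ℝ} (h : s ≤ t) :
    omega1 0 1 f s ≤ omega1 0 1 f t := by
  refine Real.sSup_le ?_ (omega1_nonneg _ _ _ _)
  rintro v ⟨x, hx, y, hy, hxy, rfl⟩
  exact abs_sub_le_omega1 hf hx hy (hxy.trans h)

lemma omegaTilde_nonneg (f : ℝ → ℝ) (t : ℝ) : 0 ≤ omegaTilde f t := by
  unfold omegaTilde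
  split_ifs
  · apply Real.sSup_nonneg
    rintro v ⟨x, y, -, hxt, hty, -, -, rfl⟩
    have h₁ := omega1_nonneg 0 1 f x
    have h₂ := omega1_nonneg 0 1 f y
    exact div_nonneg (add_nonneg (mul_nonneg (by linarith) h₂) (mul_nonneg (by linarith) h₁))
      (by linarith)
  · exact omega1_nonneg _ _ _ _

/-- The least concave majorant lies above every chord of the modulus of continuity. -/
lemma chord_le_omegaTilde {f : ℝ → ℝ} (hf : ContinuousOn f (Set.Icc 0 1)) {x y t : ℝ}
    (hx : 0 ≤ x) (hxt : x ≤ t) (hty : t ≤ y) (hy : y ≤ 1) (hxy : x < y) :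
    (t - x) * omega1 0 1 f y + (y - t) * omega1 0 1 f x ≤ omegaTilde f t * (y - x) := by
  rw [← div_le_iff₀ (by linarith), omegaTilde, if_pos (hty.trans hy)]
  refine le_csSup ⟨omega1 0 1 f 1, ?_⟩ ⟨x, y, hx, hxt, hty, hy, hxy.ne, rfl⟩
  rintro v ⟨a, b, -, hat, htb, hb, hab, rfl⟩
  have hlt : a < b := lt_of_le_of_ne (hat.trans htb) hab
  rw [div_le_iff₀ (by linarith)]
  have h₁ := mul_le_mul_of_nonneg_left (omega1_mono hf hb) (sub_nonneg.2 hat)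
  have h₂ := mul_le_mul_of_nonneg_left (omega1_mono hf (hlt.le.trans hb)) (sub_nonneg.2 htb)
  linarith

/-- A supporting line of the least concave majorant at `t`. -/
lemma exists_supporting_line {f : ℝ → ℝ} (hf : ContinuousOn f (Set.Icc 0 1)) {t : ℝ}
    (ht0 : 0 < t) (ht1 : t ≤ 1) :
    ∃ A L : ℝ, 0 ≤ A ∧ 0 ≤ L ∧ A + L * t = omegaTilde f t ∧
      ∀ s ∈ Set.Icc (0 : ℝ) 1, omega1 0 1 f s ≤ A + L * s := by
  set W := omegaTilde f t
  have hWt : omega1 0 1 f t ≤ W := by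
    have := chord_le_omegaTilde hf le_rfl ht0.le le_rfl ht1 ht0
    nlinarith
  let q : Set.Ico 0 t → ℝ := fun s => (W - omega1 0 1 f s) / (t - s)
  have : Nonempty (Set.Ico 0 t) := ⟨⟨0, le_rfl, ht0⟩⟩
  have hq : ∀ s, 0 ≤ q s := fun s =>
    div_nonneg (by linarith [omega1_mono hf s.2.2.le]) (by linarith [s.2.2])
  have hlow : ∀ s, 0 ≤ s → s < t → omega1 0 1 f s ≤ W - (⨅ r, q r) * (t - s) := by
    intro s hs hst
    have h : (⨅ r, q r) ≤ q ⟨s, hs, hst⟩ := ciInf_le ⟨0, by rintro _ ⟨r, rfl⟩; exact hq r⟩ _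
    rw [le_div_iff₀ (by simpa using hst)] at h
    linarith
  refine ⟨W - (⨅ r, q r) * t, ⨅ r, q r, ?_, le_ciInf hq, by ring, ?_⟩
  · have := hlow 0 le_rfl ht0
    linarith [omega1_nonneg 0 1 f 0]
  · rintro s ⟨hs0, hs1⟩
    rcases lt_trichotomy s t with h | rfl | h
    · linarith [hlow s hs0 h]
    · linarith
    · have : (omega1 0 1 f s - W) / (s - t) ≤ ⨅ r, q r := by
        refine le_ciInf fun r => ?_
        rw [div_le_div_iff₀ (by linarith) (by linarith [r.2.2])]
        linarith [chord_le_omegaTilde hf r.2.1 r.2.2.le h.le hs1 (r.2.2.trans h)]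
      rw [div_le_iff₀ (by linarith)] at this
      linarith

/-- A function whose oscillation is at most affine in the distance deviates from a suitable
constant by at most half the intercept plus a Lipschitz term centred at a given point. -/
lemma exists_center {f : ℝ → ℝ} (hf : ContinuousOn f (Set.Icc 0 1)) {A L : ℝ} (hL : 0 ≤ L)
    (h : ∀ s ∈ Set.Icc (0 : ℝ) 1, omega1 0 1 f s ≤ A + L * s) (x : ℝ) :
    ∃ c, ∀ p ∈ Set.Icc (0 : ℝ) 1, |f p - c| ≤ A / 2 + L * |p - x| := by
  let F : Set.Icc (0 : ℝ) 1 → ℝ := fun p => f p - A / 2 - L * |p - x|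
  have hF : ∀ p, ∀ q : Set.Icc (0 : ℝ) 1, F p ≤ f q + A / 2 + L * |q - x| := by
    intro p q
    have hpq : |(p : ℝ) - q| ∈ Set.Icc (0 : ℝ) 1 :=
      ⟨abs_nonneg _, abs_le.2 ⟨by linarith [p.2.1, q.2.2], by linarith [p.2.2, q.2.1]⟩⟩
    have h₁ := (le_abs_self _).trans ((abs_sub_le_omega1 hf p.2 q.2 le_rfl).trans (h _ hpq))
    have h₂ := mul_le_mul_of_nonneg_left (abs_sub_le (p : ℝ) x q) hL
    rw [abs_sub_comm x] at h₂
    simp only [F]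
    linarith
  have : Nonempty (Set.Icc (0 : ℝ) 1) := ⟨⟨0, by simp⟩⟩
  refine ⟨⨆ p, F p, fun p hp => abs_le.2 ⟨?_, ?_⟩⟩
  · linarith [ciSup_le fun r => hF r ⟨p, hp⟩]
  · have hb : BddAbove (Set.range F) :=
      ⟨_, by rintro _ ⟨r, rfl⟩; exact hF r ⟨p, hp⟩⟩
    have := le_ciSup hb ⟨p, hp⟩
    simp only [F] at this ⊢
    linarith

/-- The second moment of `f` about a suitable constant is controlled by the least concave
majorant evaluated at twice the standard deviation. -/
lemma exists_sum_sq_le {ι : Type*} (I : Finset ι) (w p : ι → ℝ) (hw : ∀ i ∈ I, 0 ≤ w i)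
    (hw1 : ∑ i ∈ I, w i = 1) (hp : ∀ i ∈ I, p i ∈ Set.Icc (0 : ℝ) 1) {x σ : ℝ} (hσ0 : 0 ≤ σ)
    (hσ1 : 2 * σ ≤ 1) (hσ : ∑ i ∈ I, w i * (p i - x) ^ 2 = σ ^ 2) {f : ℝ → ℝ}
    (hf : ContinuousOn f (Set.Icc 0 1)) :
    ∃ c, ∑ i ∈ I, w i * (f (p i) - c) ^ 2 ≤ (omegaTilde f (2 * σ) / 2) ^ 2 := by
  rcases hσ0.eq_or_lt with rfl | hpos
  · refine ⟨f x, (Finset.sum_nonpos fun i hi => ?_).trans (sq_nonneg _)⟩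
    rw [zero_pow two_ne_zero,
      Finset.sum_eq_zero_iff_of_nonneg fun i hi => mul_nonneg (hw i hi) (sq_nonneg _)] at hσ
    rcases mul_eq_zero.1 (hσ i hi) with h | h
    · simp [h]
    · have hpx : p i = x := sub_eq_zero.1 (pow_eq_zero_iff two_ne_zero |>.1 h)
      simp [hpx]
  · obtain ⟨A, L, hA, hL, hAL, hω⟩ := exists_supporting_line hf (by linarith : 0 < 2 * σ) hσ1
    obtain ⟨c, hc⟩ := exists_center hf hL hω x
    refine ⟨c, ?_⟩
    have habs : ∑ i ∈ I, w i * |p i - x| ≤ σ := by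
      refine abs_le_of_sq_le_sq' ?_ hσ0 |>.2
      have := Finset.sum_sq_le_sum_mul_sum_of_sq_le_mul I (r := fun i => w i * |p i - x|) hw
        (fun i hi => mul_nonneg (hw i hi) (sq_nonneg (p i - x)))
        (fun i _ => by rw [mul_pow, sq_abs]; exact le_of_eq (by ring))
      rwa [hw1, hσ, one_mul] at this
    calc ∑ i ∈ I, w i * (f (p i) - c) ^ 2
        ≤ ∑ i ∈ I, w i * (A / 2 + L * |p i - x|) ^ 2 := by
          refine Finset.sum_le_sum fun i hi => mul_le_mul_of_nonneg_left ?_ (hw i hi)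
          exact sq_le_sq' (abs_le.1 (hc _ (hp i hi))).1 (abs_le.1 (hc _ (hp i hi))).2
      _ = (A / 2) ^ 2 * ∑ i ∈ I, w i + A * L * ∑ i ∈ I, w i * |p i - x|
            + L ^ 2 * ∑ i ∈ I, w i * (p i - x) ^ 2 := by
          simp only [Finset.mul_sum, ← Finset.sum_add_distrib]
          refine Finset.sum_congr rfl fun i _ => ?_
          rw [← sq_abs (p i - x)]
          ring
      _ ≤ (A / 2) ^ 2 + A * L * σ + L ^ 2 * σ ^ 2 := by
          rw [hw1, hσ, mul_one]
          gcongr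
      _ = (omegaTilde f (2 * σ) / 2) ^ 2 := by
          rw [← hAL]
          ring

/-- The variance is at most the second moment about any constant. -/
lemma sum_sq_sub_mean_le {ι : Type*} (I : Finset ι) (w F : ι → ℝ) (hw1 : ∑ i ∈ I, w i = 1)
    (c : ℝ) :
    ∑ i ∈ I, w i * (F i - ∑ j ∈ I, w j * F j) ^ 2 ≤ ∑ i ∈ I, w i * (F i - c) ^ 2 := by
  have key : ∀ d, ∑ i ∈ I, w i * (F i - d) ^ 2
      = ∑ i ∈ I, w i * F i ^ 2 - 2 * d * ∑ i ∈ I, w i * F i + d ^ 2 := by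
    intro d
    rw [← mul_one (d ^ 2), ← hw1]
    simp only [Finset.mul_sum, ← Finset.sum_add_distrib, ← Finset.sum_sub_distrib]
    exact Finset.sum_congr rfl fun i _ => by ring
  rw [key, key]
  nlinarith [sq_nonneg (c - ∑ j ∈ I, w j * F j)]

/-- Cauchy-Schwarz bound for the covariance. -/
lemma abs_covariance_le {ι : Type*} (I : Finset ι) (w F G : ι → ℝ) (hw : ∀ i ∈ I, 0 ≤ w i)
    (hw1 : ∑ i ∈ I, w i = 1) {c d a b : ℝ} (ha : 0 ≤ a) (hb : 0 ≤ b)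
    (hF : ∑ i ∈ I, w i * (F i - c) ^ 2 ≤ a ^ 2) (hG : ∑ i ∈ I, w i * (G i - d) ^ 2 ≤ b ^ 2) :
    |∑ i ∈ I, w i * (F i * G i) - (∑ i ∈ I, w i * F i) * ∑ i ∈ I, w i * G i| ≤ a * b := by
  have hF' := (sum_sq_sub_mean_le I w F hw1 c).trans hF
  have hG' := (sum_sq_sub_mean_le I w G hw1 d).trans hG
  have hcov : ∑ i ∈ I, w i * (F i * G i) - (∑ i ∈ I, w i * F i) * ∑ i ∈ I, w i * G i
      = ∑ i ∈ I, w i * ((F i - ∑ j ∈ I, w j * F j) * (G i - ∑ j ∈ I, w j * G j)) := by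
    generalize hα : ∑ j ∈ I, w j * F j = α
    generalize hβ : ∑ j ∈ I, w j * G j = β
    have : ∑ i ∈ I, w i * ((F i - α) * (G i - β)) = ∑ i ∈ I, w i * (F i * G i)
        - β * ∑ i ∈ I, w i * F i - α * ∑ i ∈ I, w i * G i + α * β * ∑ i ∈ I, w i := by
      simp only [Finset.mul_sum, ← Finset.sum_add_distrib, ← Finset.sum_sub_distrib]
      exact Finset.sum_congr rfl fun i _ => by ring
    rw [this, hα, hβ, hw1]
    ring
  rw [hcov]
  refine abs_le_of_sq_le_sq ?_ (mul_nonneg ha hb)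
  refine (Finset.sum_sq_le_sum_mul_sum_of_sq_le_mul I
    (fun i hi => mul_nonneg (hw i hi) (sq_nonneg (F i - ∑ j ∈ I, w j * F j)))
    (fun i hi => mul_nonneg (hw i hi) (sq_nonneg (G i - ∑ j ∈ I, w j * G j)))
    (fun i _ => le_of_eq (by ring))).trans ?_
  rw [mul_pow]
  exact mul_le_mul hF' hG'
    (Finset.sum_nonneg fun i hi => mul_nonneg (hw i hi) (sq_nonneg _)) (sq_nonneg a)

/-- The variance of the Bernstein weights. -/
lemma sum_bernstein_weight_mul_sq {n : ℕ} (hn : 0 < n) {u : ℝ} (hu : u ∈ Set.Icc (0 : ℝ) 1) :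
    ∑ i ∈ Finset.range (n + 1), (n.choose i : ℝ) * u ^ i * (1 - u) ^ (n - i) * (i / n - u) ^ 2
      = u * (1 - u) / n := by
  have := bernstein.variance hn.ne' ⟨u, hu⟩
  simp only [bernstein_apply, bernstein.z] at this
  rw [← this, Finset.sum_range]
  exact Finset.sum_congr rfl fun i _ => by ring

/-- The Grüss-type inequality for the Bernstein polynomial of a single piece. -/
lemma gruss_bernsteinPiece (n m : ℕ) (hn : 0 < n) (hm : 0 < m) (k : ℕ) (hk1 : 1 ≤ k)
    (hk2 : k ≤ m) (f g : ℝ → ℝ) (hf : ContinuousOn f (Set.Icc 0 1))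
    (hg : ContinuousOn g (Set.Icc 0 1)) (x : ℝ)
    (hx : x ∈ Set.Icc (((k : ℝ) - 1) / (m : ℝ)) ((k : ℝ) / (m : ℝ))) :
    |bernsteinPiece n m k (fun t => f t * g t) x
        - bernsteinPiece n m k f x * bernsteinPiece n m k g x| ≤
      1 / 4 *
        omegaTilde f (2 * Real.sqrt
          ((x - ((k : ℝ) - 1) / (m : ℝ)) * ((k : ℝ) / (m : ℝ) - x) / (n : ℝ))) *
        omegaTilde g (2 * Real.sqrt
          ((x - ((k : ℝ) - 1) / (m : ℝ)) * ((k : ℝ) / (m : ℝ) - x) / (n : ℝ))) := by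
  have hn1 : (1 : ℝ) ≤ n := by exact_mod_cast hn
  have hm1 : (1 : ℝ) ≤ m := by exact_mod_cast hm
  have hk1' : (1 : ℝ) ≤ k := by exact_mod_cast hk1
  have hk2' : (k : ℝ) ≤ m := by exact_mod_cast hk2
  have hn0 : (n : ℝ) ≠ 0 := by positivity
  have hm0 : (m : ℝ) ≠ 0 := by positivity
  obtain ⟨u, hu⟩ : ∃ u : ℝ, u = m * x - (k - 1) := ⟨_, rfl⟩
  have hleft : x - ((k : ℝ) - 1) / m = u / m := by
    rw [hu]; field_simp
  have hright : (k : ℝ) / m - x = (1 - u) / m := by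
    rw [hu]; field_simp; ring
  have hu01 : u ∈ Set.Icc (0 : ℝ) 1 := by
    have h₁ := hx.1
    have h₂ := hx.2
    rw [div_le_iff₀ (by positivity)] at h₁
    rw [le_div_iff₀ (by positivity)] at h₂
    exact ⟨by linarith, by linarith⟩
  have hu0 := hu01.1
  have hu1 : 0 ≤ 1 - u := sub_nonneg.2 hu01.2
  let w : ℕ → ℝ := fun i => (n.choose i : ℝ) * u ^ i * (1 - u) ^ (n - i)
  let p : ℕ → ℝ := fun i => ((k : ℝ) * n - n + i) / ((m : ℝ) * n)
  have hpiece : ∀ F : ℝ → ℝ,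
      bernsteinPiece n m k F x = ∑ i ∈ Finset.range (n + 1), w i * F (p i) := by
    intro F
    rw [bernsteinPiece, Finset.mul_sum]
    refine Finset.sum_congr rfl fun i hi => ?_
    have hin : i + (n - i) = n := by have := Finset.mem_range.1 hi; omega
    have hpow : (m : ℝ) ^ n = m ^ i * m ^ (n - i) := by rw [← pow_add, hin]
    rw [hleft, hright, hpow, div_pow, div_pow]
    simp only [w, p]
    field_simp
  have hw : ∀ i ∈ Finset.range (n + 1), 0 ≤ w i := fun i _ => by positivity
  have hw1 : ∑ i ∈ Finset.range (n + 1), w i = 1 := by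
    have := add_pow u (1 - u) n
    rw [add_sub_cancel, one_pow] at this
    rw [this]
    exact Finset.sum_congr rfl fun i _ => by simp only [w]; ring
  have hp : ∀ i ∈ Finset.range (n + 1), p i ∈ Set.Icc (0 : ℝ) 1 := by
    intro i hi
    have hin : (i : ℝ) ≤ n := by exact_mod_cast Finset.mem_range_succ_iff.1 hi
    have hi0 : (0 : ℝ) ≤ i := i.cast_nonneg
    refine ⟨div_nonneg (by nlinarith) (by positivity), ?_⟩
    rw [div_le_one (by positivity)]
    nlinarith
  set v := (x - ((k : ℝ) - 1) / m) * ((k : ℝ) / m - x) / n with hv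
  have hv' : v = u * (1 - u) / n / m ^ 2 := by
    rw [hv, hleft, hright]; field_simp
  have hv0 : 0 ≤ v := by rw [hv']; positivity
  have hσ : ∑ i ∈ Finset.range (n + 1), w i * (p i - x) ^ 2 = √v ^ 2 := by
    rw [Real.sq_sqrt hv0, hv', ← sum_bernstein_weight_mul_sq hn hu01, Finset.sum_div]
    refine Finset.sum_congr rfl fun i _ => ?_
    have : p i - x = (i / n - u) / m := by
      simp only [p]; rw [hu]; field_simp; ring
    rw [this]
    simp only [w]
    ring
  have hσ1 : 2 * √v ≤ 1 := by
    have : √v ≤ 1 / 2 := by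
      rw [Real.sqrt_le_left (by norm_num), hv', div_div, div_le_iff₀ (by positivity)]
      nlinarith [sq_nonneg (u - 1 / 2), one_le_mul_of_one_le_of_one_le hn1
        (one_le_pow₀ hm1 (n := 2))]
    linarith
  obtain ⟨c, hc⟩ := exists_sum_sq_le _ w p hw hw1 hp (Real.sqrt_nonneg v) hσ1 hσ hf
  obtain ⟨d, hd⟩ := exists_sum_sq_le _ w p hw hw1 hp (Real.sqrt_nonneg v) hσ1 hσ hg
  rw [hpiece, hpiece, hpiece]
  refine (abs_covariance_le _ w (fun i => f (p i)) (fun i => g (p i)) hw hw1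
    (by linarith [omegaTilde_nonneg f (2 * √v)]) (by linarith [omegaTilde_nonneg g (2 * √v)])
    hc hd).trans_eq ?_
  ring

/-- A point of the `k`-th piece is assigned index `k`, unless it is the right end point. -/
lemma pieceIdx_eq_or {m k : ℕ} (hm : 0 < m) (hk1 : 1 ≤ k) (hk2 : k ≤ m) {x : ℝ}
    (hx : x ∈ Set.Icc (((k : ℝ) - 1) / (m : ℝ)) ((k : ℝ) / (m : ℝ))) :
    pieceIdx m x = k ∨ (pieceIdx m x = k + 1 ∧ k + 1 ≤ m ∧ x = k / m) := by
  have hm' : (0 : ℝ) < m := by exact_mod_cast hm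
  have h₁ := hx.1
  rw [div_le_iff₀ hm'] at h₁
  rcases hx.2.eq_or_lt with h | h
  · have : ⌊(m : ℝ) * x⌋ = k := by rw [h, mul_div_cancel₀ _ hm'.ne']; simp
    rcases hk2.eq_or_lt with hkm | hkm
    · left; simp only [pieceIdx, this]; omega
    · right; refine ⟨?_, hkm, h⟩; simp only [pieceIdx, this]; omega
  · rw [lt_div_iff₀ hm'] at h
    have : ⌊(m : ℝ) * x⌋ = (k : ℤ) - 1 := by
      rw [Int.floor_eq_iff]; push_cast; exact ⟨by linarith, by linarith⟩
    left; simp only [pieceIdx, this]; omega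

theorem gruss_compBernstein
    (n m : ℕ) (hn : 0 < n) (hm : 0 < m) (k : ℕ) (hk1 : 1 ≤ k) (hk2 : k ≤ m)
    (f g : ℝ → ℝ) (hf : ContinuousOn f (Set.Icc 0 1)) (hg : ContinuousOn g (Set.Icc 0 1))
    (x : ℝ) (hx : x ∈ Set.Icc (((k : ℝ) - 1) / (m : ℝ)) ((k : ℝ) / (m : ℝ))) :
    |compBernstein n m (fun t => f t * g t) x - compBernstein n m f x * compBernstein n m g x| ≤
      1 / 4 *
        omegaTilde f (2 * Real.sqrt
          ((x - ((k : ℝ) - 1) / (m : ℝ)) * ((k : ℝ) / (m : ℝ) - x) / (n : ℝ))) *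
        omegaTilde g (2 * Real.sqrt
          ((x - ((k : ℝ) - 1) / (m : ℝ)) * ((k : ℝ) / (m : ℝ) - x) / (n : ℝ))) := by
  rcases pieceIdx_eq_or hm hk1 hk2 hx with h | ⟨h, hkm, hxk⟩
  · simp only [compBernstein, h]
    exact gruss_bernsteinPiece n m hn hm k hk1 hk2 f g hf hg x hx
  · simp only [compBernstein, h]
    have hx' : x ∈ Set.Icc ((((k + 1 : ℕ) : ℝ) - 1) / (m : ℝ)) (((k + 1 : ℕ) : ℝ) / (m : ℝ)) := by
      push_cast
      rw [hxk, add_sub_cancel_right]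
      exact ⟨le_rfl, by gcongr; linarith⟩
    have := gruss_bernsteinPiece n m hn hm (k + 1) (by omega) hkm f g hf hg x hx'
    have e₁ : x - (((k + 1 : ℕ) : ℝ) - 1) / (m : ℝ) = 0 := by
      push_cast
      rw [hxk, add_sub_cancel_right, sub_self]
    have e₂ : (k : ℝ) / (m : ℝ) - x = 0 := by rw [hxk, sub_self]
    rw [e₁, zero_mul] at this
    rwa [e₂, mul_zero]
end
end

section
/- Let n, m be positive integers. For every f ∈ C[0,1], the composite Bernstein quadrature value equals I_{n,m}(f) := ∫₀¹ B̄_{n,m}(f; x) dx = (1/(m(n+1))) · Σ_{k=1}^{m} Σ_{i=0}^{n} f((kn - n + i)/(m·n)). -/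
open Set Finset

noncomputable section

theorem integral_sub_pow_mul_sub_pow (a b : ℝ) (i j : ℕ) :
    (((i + j).choose i : ℕ) : ℝ) * ((i : ℝ) + j + 1) * ∫ x in a..b, (x - a) ^ i * (b - x) ^ j =
      (b - a) ^ (i + j + 1) := by
  induction j generalizing i with
  | zero =>
    have h : ∫ x in a..b, (x - a) ^ i = (b - a) ^ (i + 1) / (i + 1) := by
      rw [intervalIntegral.integral_comp_sub_right (fun x => x ^ i), integral_pow]
      simp
    have hi : (i : ℝ) + 1 ≠ 0 := by positivity
    simp [h]
    field_simp
  | succ j ih =>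
    have hparts : ((i : ℝ) + 1) * (∫ x in a..b, (x - a) ^ i * (b - x) ^ (j + 1)) =
        ((j : ℝ) + 1) * ∫ x in a..b, (x - a) ^ (i + 1) * (b - x) ^ j := by
      have hderiv : ∀ x ∈ Set.uIcc a b,
          HasDerivAt (fun x : ℝ => (x - a) ^ (i + 1) * (b - x) ^ (j + 1))
            (((i : ℝ) + 1) * ((x - a) ^ i * (b - x) ^ (j + 1)) -
              ((j : ℝ) + 1) * ((x - a) ^ (i + 1) * (b - x) ^ j)) x := by
        intro x _
        have h := (((hasDerivAt_id x).sub_const a).pow (i + 1)).mul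
          (((hasDerivAt_id x).const_sub b).pow (j + 1))
        refine h.congr_deriv ?_
        simp
        ring
      have h := intervalIntegral.integral_eq_sub_of_hasDerivAt hderiv
        (Continuous.intervalIntegrable (by fun_prop) _ _)
      rw [intervalIntegral.integral_sub (Continuous.intervalIntegrable (by fun_prop) _ _)
        (Continuous.intervalIntegrable (by fun_prop) _ _), intervalIntegral.integral_const_mul,
        intervalIntegral.integral_const_mul] at h
      simp at h
      linarith
    have hchoose : (((i + j + 1).choose (i + 1) : ℕ) : ℝ) * (i + 1) =
        (((i + j + 1).choose i : ℕ) : ℝ) * (j + 1) := by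
      have h := Nat.choose_succ_right_eq (i + j + 1) i
      rw [show i + j + 1 - i = j + 1 by omega] at h
      exact_mod_cast h
    have hih := ih (i + 1)
    rw [show i + 1 + j = i + j + 1 by ring] at hih
    rw [← add_assoc i j 1, ← hih]
    have hi : (i : ℝ) + 1 ≠ 0 := by positivity
    apply mul_left_cancel₀ hi
    push_cast
    linear_combination (((i + j + 1).choose i : ℕ) : ℝ) * ((i : ℝ) + j + 2) * hparts -
      ((i : ℝ) + j + 2) * (∫ x in a..b, (x - a) ^ (i + 1) * (b - x) ^ j) * hchoose

theorem continuous_bernsteinPiece (n m k : ℕ) (f : ℝ → ℝ) :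
    Continuous (bernsteinPiece n m k f) := by
  unfold bernsteinPiece
  fun_prop

theorem integral_bernsteinPiece (n m k : ℕ) (hm : 0 < m) (f : ℝ → ℝ) :
    ∫ x in ((k : ℝ) - 1) / m..(k : ℝ) / m, bernsteinPiece n m k f x =
      1 / ((m : ℝ) * ((n : ℝ) + 1)) * ∑ i ∈ Finset.range (n + 1),
        f (((k : ℝ) * n - n + i) / ((m : ℝ) * n)) := by
  unfold bernsteinPiece
  rw [intervalIntegral.integral_const_mul, intervalIntegral.integral_finsetSum
    (fun i _ => Continuous.intervalIntegrable (by fun_prop) _ _), Finset.mul_sum, Finset.mul_sum]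
  refine Finset.sum_congr rfl fun i hi => ?_
  obtain ⟨j, rfl⟩ := Nat.exists_eq_add_of_le (Nat.lt_succ_iff.mp (Finset.mem_range.mp hi))
  have h := integral_sub_pow_mul_sub_pow (((k : ℝ) - 1) / m) ((k : ℝ) / m) i j
  have hm' : (m : ℝ) ≠ 0 := by positivity
  have hn' : (i : ℝ) + j + 1 ≠ 0 := by positivity
  rw [show (k : ℝ) / m - ((k : ℝ) - 1) / m = 1 / m by ring, div_pow, one_pow] at h
  rw [intervalIntegral.integral_mul_const]
  simp only [mul_assoc, intervalIntegral.integral_const_mul, Nat.add_sub_cancel_left]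
  rw [← mul_assoc (((i + j).choose i : ℕ) : ℝ), ← mul_assoc ((m : ℝ) ^ (i + j))]
  push_cast
  congr 1
  rw [eq_div_iff (by positivity)] at h ⊢
  linear_combination h

theorem pieceIdx_eq_succ {m k : ℕ} (hk : k < m) {x : ℝ}
    (hx : x ∈ Set.Ioo ((k : ℝ) / m) (((k : ℝ) + 1) / m)) : pieceIdx m x = k + 1 := by
  have hm : (0 : ℝ) < m := by exact_mod_cast Nat.zero_lt_of_lt hk
  have h₁ := (div_lt_iff₀' hm).mp hx.1
  have h₂ := (lt_div_iff₀' hm).mp hx.2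
  have hfloor : ⌊(m : ℝ) * x⌋ = (k : ℤ) := by
    rw [Int.floor_eq_iff]
    exact ⟨by exact_mod_cast h₁.le, by exact_mod_cast h₂⟩
  simp only [pieceIdx, hfloor, Int.toNat_natCast]
  omega

theorem compBernstein_eqOn {n m k : ℕ} (hk : k < m) (f : ℝ → ℝ) :
    Set.EqOn (bernsteinPiece n m (k + 1) f) (compBernstein n m f)
      (Set.Ioo ((k : ℝ) / m) (((k : ℝ) + 1) / m)) := by
  intro x hx
  simp only [compBernstein, pieceIdx_eq_succ hk hx]

theorem quadrature_formula
    (n m : ℕ) (hn : 0 < n) (hm : 0 < m)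
    (f : ℝ → ℝ) (hf : ContinuousOn f (Set.Icc 0 1)) :
    ∫ x in (0 : ℝ)..1, compBernstein n m f x =
      (1 / ((m : ℝ) * ((n : ℝ) + 1))) * ∑ k ∈ Finset.Icc 1 m, ∑ i ∈ Finset.range (n + 1),
        f (((k : ℝ) * n - n + i) / ((m : ℝ) * n)) := by
  have hm' : (m : ℝ) ≠ 0 := by positivity
  have hle (k : ℕ) : (k : ℝ) / m ≤ ((k : ℝ) + 1) / m := by gcongr; linarith
  have hint : ∀ k < m, IntervalIntegrable (compBernstein n m f) MeasureTheory.volume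
      ((k : ℝ) / m) (((k + 1 : ℕ) : ℝ) / m) := by
    intro k hk
    push_cast
    refine ((continuous_bernsteinPiece n m (k + 1) f).intervalIntegrable _ _).congr_uIoo ?_
    rw [Set.uIoo_of_le (hle k)]
    exact compBernstein_eqOn hk f
  have hsum := intervalIntegral.sum_integral_adjacent_intervals hint
  rw [Nat.cast_zero, zero_div, div_self hm'] at hsum
  rw [← hsum, ← Finset.Ico_add_one_right_eq_Icc, Finset.sum_Ico_eq_sum_range, Finset.mul_sum,
    Nat.add_sub_cancel]
  refine Finset.sum_congr rfl fun k hk => ?_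
  rw [add_comm 1 k, ← integral_bernsteinPiece n m (k + 1) hm f]
  push_cast
  rw [add_sub_cancel_right]
  refine (intervalIntegral.integral_congr_uIoo ?_).symm
  rw [Set.uIoo_of_le (hle k)]
  exact compBernstein_eqOn (Finset.mem_range.mp hk) f
end
end

section
/- Let n, m be positive integers. For every g ∈ C²[0,1] (g twice continuously differentiable on [0,1]), one has |∫₀¹ g(x) dx - I_{n,m}(g)| ≤ ‖g″‖_∞/(12·m²·n). -/
open Set Finset

noncomputable section

/-- The sup norm of `f` on `[a,b]`. -/
def supAbs (a b : ℝ) (f : ℝ → ℝ) : ℝ := sSup ((fun x => |f x|) '' Set.Icc a b)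

/-- The composite Bernstein quadrature functional `I_{n,m}`. -/
def quadI (n m : ℕ) (f : ℝ → ℝ) : ℝ :=
  (1 / ((m : ℝ) * ((n : ℝ) + 1))) * ∑ k ∈ Finset.Icc 1 m, ∑ i ∈ Finset.range (n + 1),
    f (((k : ℝ) * n - n + i) / ((m : ℝ) * n))

/-- The trapezoid rule overestimates the integral of a convex function. -/
theorem integral_le_trapezoid_of_convexOn {a b : ℝ} (hab : a < b) {f : ℝ → ℝ}
    (hf : ConvexOn ℝ (Set.Icc a b) f) (hc : ContinuousOn f (Set.Icc a b)) :
    ∫ x in a..b, f x ≤ (b - a) * ((f a + f b) / 2) := by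
  have hba : 0 < b - a := sub_pos.2 hab
  have hchord : ∫ x in a..b, (f a + (x - a) * ((f b - f a) / (b - a))) =
      (b - a) * ((f a + f b) / 2) := by
    rw [intervalIntegral.integral_add (by simp)
      ((by fun_prop : Continuous fun x : ℝ => (x - a) * ((f b - f a) / (b - a))).intervalIntegrable
        _ _), intervalIntegral.integral_mul_const, intervalIntegral.integral_sub (by simp) (by simp)]
    simp only [intervalIntegral.integral_const, integral_id, smul_eq_mul]
    field_simp
    ring
  rw [← hchord]
  refine intervalIntegral.integral_mono_on hab.le
    (hc.mono (by rw [Set.uIcc_of_le hab.le])).intervalIntegrable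
    ((by fun_prop : Continuous fun x : ℝ =>
      f a + (x - a) * ((f b - f a) / (b - a))).intervalIntegrable _ _) fun x hx => ?_
  have h := hf.2 (Set.left_mem_Icc.2 hab.le) (Set.right_mem_Icc.2 hab.le)
    (div_nonneg (sub_nonneg.2 hx.2) hba.le) (div_nonneg (sub_nonneg.2 hx.1) hba.le)
    (by field_simp; ring)
  simp only [smul_eq_mul] at h
  rw [show (b - x) / (b - a) * a + (x - a) / (b - a) * b = x by field_simp; ring] at h
  refine h.trans_eq ?_
  field_simp
  ring

/-- The mean of a convex function over equally spaced nodes, endpoints included, is at most the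
mean of its two endpoint values. -/
theorem sum_equispaced_le_of_convexOn {a h : ℝ} {n : ℕ} (hn : 0 < n) (hh : 0 < h) {f : ℝ → ℝ}
    (hf : ConvexOn ℝ (Set.Icc a (a + n * h)) f) :
    ∑ i ∈ Finset.range (n + 1), f (a + i * h) ≤ (n + 1) * ((f a + f (a + n * h)) / 2) := by
  have hn' : (0 : ℝ) < n := by exact_mod_cast hn
  have hle : a ≤ a + n * h := by nlinarith [mul_pos hn' hh]
  have hterm : ∀ i ∈ Finset.range (n + 1),
      f (a + i * h) ≤ f a + i * ((f (a + n * h) - f a) / n) := by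
    intro i hi
    have hin : (i : ℝ) ≤ n := by exact_mod_cast Nat.lt_succ_iff.1 (Finset.mem_range.1 hi)
    have key := hf.2 (Set.left_mem_Icc.2 hle) (Set.right_mem_Icc.2 hle)
      (div_nonneg (sub_nonneg.2 hin) hn'.le) (div_nonneg i.cast_nonneg hn'.le)
      (by field_simp; ring)
    simp only [smul_eq_mul] at key
    rw [show ((n : ℝ) - i) / n * a + i / n * (a + n * h) = a + i * h by field_simp; ring] at key
    refine key.trans_eq ?_
    field_simp
    ring
  refine (Finset.sum_le_sum hterm).trans_eq ?_
  have hsum : ∀ k : ℕ, ∑ i ∈ Finset.range (k + 1), (i : ℝ) = k * (k + 1) / 2 := by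
    intro k
    induction k with
    | zero => simp
    | succ k ih => rw [Finset.sum_range_succ, ih]; push_cast; ring
  rw [Finset.sum_add_distrib, ← Finset.sum_mul, hsum]
  simp only [Finset.sum_const, Finset.card_range, nsmul_eq_mul]
  push_cast
  field_simp
  ring

/-- The mean of a convex function over equally spaced nodes, endpoints included, overestimates its
integral mean. -/
theorem integral_le_sum_equispaced_of_convexOn {a h : ℝ} {n : ℕ} (hn : 0 < n) (hh : 0 < h)
    {f : ℝ → ℝ} (hf : ConvexOn ℝ (Set.Icc a (a + n * h)) f)
    (hc : ContinuousOn f (Set.Icc a (a + n * h))) :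
    ∫ x in a..(a + n * h), f x ≤
      n * h / (n + 1) * ∑ i ∈ Finset.range (n + 1), f (a + i * h) := by
  have hn' : (0 : ℝ) < n := by exact_mod_cast hn
  have hsub : ∀ i < n,
      Set.Icc (a + i * h) (a + (i + 1 : ℕ) * h) ⊆ Set.Icc a (a + n * h) := by
    intro i hi
    have hin : ((i + 1 : ℕ) : ℝ) ≤ n := by exact_mod_cast hi
    apply Set.Icc_subset_Icc
    · nlinarith [mul_nonneg (Nat.cast_nonneg (α := ℝ) i) hh.le]
    · nlinarith
  have hlt : ∀ i : ℕ, a + i * h < a + (i + 1 : ℕ) * h := by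
    intro i
    push_cast
    linarith
  have hsplit := intervalIntegral.sum_integral_adjacent_intervals (n := n) (f := f)
    (μ := MeasureTheory.volume) (a := fun i : ℕ => a + i * h) fun i hi =>
      (hc.mono (by rw [Set.uIcc_of_le (hlt i).le]; exact hsub i hi)).intervalIntegrable
  simp only [Nat.cast_zero, zero_mul, add_zero] at hsplit
  have htrap : ∫ x in a..(a + n * h), f x ≤
      ∑ i ∈ Finset.range n, h * ((f (a + i * h) + f (a + (i + 1 : ℕ) * h)) / 2) := by
    rw [← hsplit]
    refine Finset.sum_le_sum fun i hi => ?_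
    have hi' := hsub i (Finset.mem_range.1 hi)
    refine (integral_le_trapezoid_of_convexOn (hlt i) (hf.subset hi' (convex_Icc _ _))
      (hc.mono hi')).trans_eq ?_
    push_cast
    ring
  have htel : ∑ i ∈ Finset.range n, h * ((f (a + i * h) + f (a + (i + 1 : ℕ) * h)) / 2) =
      h * (∑ i ∈ Finset.range (n + 1), f (a + i * h) - (f a + f (a + n * h)) / 2) := by
    have h₁ := Finset.sum_range_succ (fun i : ℕ => f (a + i * h)) n
    have h₂ := Finset.sum_range_succ' (fun i : ℕ => f (a + i * h)) n
    simp only [Nat.cast_zero, zero_mul, add_zero] at h₂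
    rw [← Finset.mul_sum, ← Finset.sum_div, Finset.sum_add_distrib]
    congr 1
    linarith
  have hmean := sum_equispaced_le_of_convexOn hn hh hf
  rw [htel] at htrap
  refine htrap.trans ?_
  rw [div_mul_eq_mul_div, le_div_iff₀ (by positivity)]
  nlinarith [mul_le_mul_of_nonneg_left hmean hh.le]

/-- `quadI` overestimates the integral of a convex function. -/
theorem integral_le_quadI_of_convexOn {n m : ℕ} (hn : 0 < n) (hm : 0 < m) {f : ℝ → ℝ}
    (hf : ConvexOn ℝ (Set.Icc 0 1) f) (hc : ContinuousOn f (Set.Icc 0 1)) :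
    ∫ x in (0 : ℝ)..1, f x ≤ quadI n m f := by
  have hn' : (0 : ℝ) < n := by exact_mod_cast hn
  have hm' : (0 : ℝ) < m := by exact_mod_cast hm
  have hend : ∀ k : ℕ, (k : ℝ) / m + n * (1 / (m * n)) = ((k + 1 : ℕ) : ℝ) / m := by
    intro k
    push_cast
    field_simp
  have hsub : ∀ k < m, Set.Icc ((k : ℝ) / m) (((k + 1 : ℕ) : ℝ) / m) ⊆ Set.Icc 0 1 := by
    intro k hk
    have hkm : ((k + 1 : ℕ) : ℝ) ≤ m := by exact_mod_cast hk
    exact Set.Icc_subset_Icc (by positivity) ((div_le_one hm').2 hkm)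
  have hle : ∀ k : ℕ, (k : ℝ) / m ≤ ((k + 1 : ℕ) : ℝ) / m := by
    intro k
    gcongr
    simp
  have hsplit := intervalIntegral.sum_integral_adjacent_intervals (n := m) (f := f)
    (μ := MeasureTheory.volume) (a := fun k : ℕ => (k : ℝ) / m) fun k hk =>
      (hc.mono (by rw [Set.uIcc_of_le (hle k)]; exact hsub k hk)).intervalIntegrable
  simp only [Nat.cast_zero, zero_div, div_self hm'.ne'] at hsplit
  rw [← hsplit, quadI, Finset.mul_sum, Finset.sum_bij (s := Finset.Icc 1 m) (t := Finset.range m)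
    (g := fun k : ℕ => 1 / ((m : ℝ) * ((n : ℝ) + 1)) * ∑ i ∈ Finset.range (n + 1),
      f ((k : ℝ) / m + i * (1 / (m * n)))) (i := fun k _ => k - 1)]
  · refine Finset.sum_le_sum fun k hk => ?_
    have hk' := hsub k (Finset.mem_range.1 hk)
    rw [← hend k] at hk' ⊢
    refine (integral_le_sum_equispaced_of_convexOn hn (by positivity)
      (hf.subset hk' (convex_Icc _ _)) (hc.mono hk')).trans_eq ?_
    congr 1
    field_simp
  · intro k hk
    simp only [Finset.mem_Icc, Finset.mem_range] at hk ⊢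
    omega
  · intro k hk l hl hkl
    simp only [Finset.mem_Icc] at hk hl
    omega
  · intro k hk
    exact ⟨k + 1, by simp only [Finset.mem_Icc, Finset.mem_range] at hk ⊢; omega, by simp⟩
  · intro k hk
    rw [Nat.cast_sub (Finset.mem_Icc.1 hk).1]
    congr 1
    refine Finset.sum_congr rfl fun i _ => ?_
    congr 1
    push_cast
    field_simp

theorem quadI_add (n m : ℕ) (f g : ℝ → ℝ) :
    quadI n m (fun x => f x + g x) = quadI n m f + quadI n m g := by
  simp only [quadI, Finset.sum_add_distrib, mul_add]

theorem quadI_const_mul (n m : ℕ) (c : ℝ) (f : ℝ → ℝ) :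
    quadI n m (fun x => c * f x) = c * quadI n m f := by
  simp only [quadI, ← Finset.mul_sum]
  ring

theorem quadI_sq {n m : ℕ} (hn : 0 < n) (hm : 0 < m) :
    quadI n m (fun x => x ^ 2) = 1 / 3 + 1 / (6 * (m : ℝ) ^ 2 * n) := by
  have hn' : (0 : ℝ) < n := by exact_mod_cast hn
  have hm' : (0 : ℝ) < m := by exact_mod_cast hm
  have hinner : ∀ (A : ℝ) (l : ℕ), ∑ i ∈ Finset.range (l + 1), (A + (i : ℝ)) ^ 2 =
      (l + 1) * (A ^ 2 + A * l + l * (2 * l + 1) / 6) := by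
    intro A l
    induction l with
    | zero => simp
    | succ l ih => rw [Finset.sum_range_succ, ih]; push_cast; ring
  have houter : ∀ l : ℕ, ∑ k ∈ Finset.Icc 1 l, (((k : ℝ) * n - n) ^ 2 + ((k : ℝ) * n - n) * n +
      n * (2 * n + 1) / 6) = (l : ℝ) ^ 3 * n ^ 2 / 3 + l * n / 6 := by
    intro l
    induction l with
    | zero => simp
    | succ l ih => rw [Finset.sum_Icc_succ_top (by omega), ih]; push_cast; ring
  simp only [quadI, div_pow, ← Finset.sum_div, hinner]
  rw [← Finset.mul_sum, houter]
  field_simp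

/-- If `M + σ * g'' ≥ 0` on `[0, 1]` then `M / 2 * x ^ 2 + σ * g x` is convex there. -/
theorem convexOn_sq_add_mul {g : ℝ → ℝ} (hg : ContDiffOn ℝ 2 g (Set.Icc 0 1)) {M σ : ℝ}
    (hM : ∀ x ∈ Set.Icc (0 : ℝ) 1, 0 ≤ M + σ * iteratedDerivWithin 2 g (Set.Icc 0 1) x) :
    ConvexOn ℝ (Set.Icc 0 1) (fun x => M / 2 * x ^ 2 + σ * g x) := by
  have hu : UniqueDiffOn ℝ (Set.Icc (0 : ℝ) 1) := uniqueDiffOn_Icc zero_lt_one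
  have hd : DifferentiableOn ℝ g (Set.Icc 0 1) := hg.differentiableOn (by norm_num)
  have hd' : DifferentiableOn ℝ (derivWithin g (Set.Icc 0 1)) (Set.Icc 0 1) :=
    (hg.derivWithin hu (m := 1) (by norm_num)).differentiableOn (by norm_num)
  have hsub : interior (Set.Icc (0 : ℝ) 1) ⊆ Set.Icc 0 1 := interior_subset
  refine convexOn_of_hasDerivWithinAt2_nonneg (convex_Icc 0 1)
    (f' := fun x => M * x + σ * derivWithin g (Set.Icc 0 1) x)
    (f'' := fun x => M + σ * iteratedDerivWithin 2 g (Set.Icc 0 1) x)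
    (by have := hg.continuousOn; fun_prop) (fun x hx => ?_) (fun x hx => ?_)
    (fun x hx => hM x (hsub hx))
  · have h₁ := ((hd x (hsub hx)).hasDerivWithinAt.mono hsub).const_mul σ
    have h₂ := ((hasDerivWithinAt_id x (interior (Set.Icc (0 : ℝ) 1))).pow 2).const_mul (M / 2)
    refine (h₂.add h₁).congr_deriv ?_
    simp
    ring
  · have h₁ := ((hd' x (hsub hx)).hasDerivWithinAt.mono hsub).const_mul σ
    have h₂ := (hasDerivWithinAt_id x (interior (Set.Icc (0 : ℝ) 1))).const_mul M
    refine (h₂.add h₁).congr_deriv ?_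
    rw [iteratedDerivWithin_succ, iteratedDerivWithin_one]
    simp

theorem quadrature_error_C2
    (n m : ℕ) (hn : 0 < n) (hm : 0 < m)
    (g : ℝ → ℝ) (hg : ContDiffOn ℝ 2 g (Set.Icc 0 1)) :
    |(∫ x in (0 : ℝ)..1, g x) - quadI n m g| ≤
      supAbs 0 1 (iteratedDerivWithin 2 g (Set.Icc 0 1)) / (12 * (m : ℝ) ^ 2 * (n : ℝ)) := by
  set M := supAbs 0 1 (iteratedDerivWithin 2 g (Set.Icc 0 1))
  have hbound : ∀ x ∈ Set.Icc (0 : ℝ) 1, |iteratedDerivWithin 2 g (Set.Icc 0 1) x| ≤ M := by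
    intro x hx
    have hc := hg.continuousOn_iteratedDerivWithin (m := 2) le_rfl (uniqueDiffOn_Icc zero_lt_one)
    exact le_csSup (isCompact_Icc.image_of_continuousOn hc.abs).bddAbove ⟨x, hx, rfl⟩
  have hgi : IntervalIntegrable g MeasureTheory.volume 0 1 :=
    (hg.continuousOn.mono (by rw [Set.uIcc_of_le zero_le_one])).intervalIntegrable
  have hdiv : M / (12 * (m : ℝ) ^ 2 * n) = M / 2 * (1 / (6 * (m : ℝ) ^ 2 * n)) := by
    ring
  have key : ∀ σ : ℝ, (∀ x ∈ Set.Icc (0 : ℝ) 1,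
      0 ≤ M + σ * iteratedDerivWithin 2 g (Set.Icc 0 1) x) →
      σ * ((∫ x in (0 : ℝ)..1, g x) - quadI n m g) ≤ M / (12 * (m : ℝ) ^ 2 * n) := by
    intro σ hσ
    have h := integral_le_quadI_of_convexOn hn hm (convexOn_sq_add_mul hg hσ)
      (by have := hg.continuousOn; fun_prop)
    rw [quadI_add n m (fun x => M / 2 * x ^ 2) (fun x => σ * g x), quadI_const_mul,
      quadI_const_mul, quadI_sq hn hm, intervalIntegral.integral_add
        ((by fun_prop : Continuous fun x : ℝ => M / 2 * x ^ 2).intervalIntegrable _ _)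
        (hgi.const_mul σ), intervalIntegral.integral_const_mul,
      intervalIntegral.integral_const_mul, integral_pow] at h
    rw [hdiv]
    norm_num at h ⊢
    linarith
  refine abs_le'.2 ⟨?_, ?_⟩
  · have := key 1 fun x hx => by linarith [neg_le_of_abs_le (hbound x hx)]
    linarith
  · have := key (-1) fun x hx => by linarith [le_of_abs_le (hbound x hx)]
    linarith
end
end

section
/- Let n, m be positive integers. For every f ∈ C[0,1], one has |∫₀¹ f(x) dx - I_{n,m}(f)| ≤ (9/4)·ω₂(f; 1/(m·√(6n))). -/
open Set Finset

noncomputable section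

/-- Second order modulus of smoothness of `f` on `[a,b]`. -/
def omega2 (a b : ℝ) (f : ℝ → ℝ) (δ : ℝ) : ℝ :=
  sSup {v | ∃ x h : ℝ, x - h ∈ Set.Icc a b ∧ x + h ∈ Set.Icc a b ∧ |h| ≤ δ ∧
    v = |f (x - h) - 2 * f x + f (x + h)|}

/-- The second differences of `g` in `[0,1]` with step at most `δ` are bounded by `w`. -/
def SecondDiffBound (g : ℝ → ℝ) (δ w : ℝ) : Prop :=
  ∀ x h : ℝ, 0 ≤ h → h ≤ δ → 0 ≤ x - h → x + h ≤ 1 → |g (x - h) - 2 * g x + g (x + h)| ≤ w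

theorem secondDiffBound_omega2 {f : ℝ → ℝ} (hf : ContinuousOn f (Set.Icc 0 1)) (δ : ℝ) :
    SecondDiffBound f δ (omega2 0 1 f δ) := by
  intro x h h0 hδ hx1 hx2
  obtain ⟨C, hC⟩ := isCompact_Icc.exists_bound_of_continuousOn hf
  refine le_csSup ⟨4 * C, ?_⟩ ⟨x, h, ⟨hx1, by linarith⟩, ⟨by linarith, hx2⟩,
    by rwa [abs_of_nonneg h0], rfl⟩
  rintro v ⟨y, k, hy1, hy2, -, rfl⟩
  have b1 := abs_le.mp (hC _ hy1)
  have b2 := abs_le.mp (hC _ hy2)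
  have b3 := abs_le.mp (hC y ⟨by linarith [hy1.1, hy2.1], by linarith [hy1.2, hy2.2]⟩)
  rw [abs_le]
  constructor <;> linarith [b1.1, b1.2, b2.1, b2.2, b3.1, b3.2]

theorem SecondDiffBound.nonneg {g : ℝ → ℝ} {δ w : ℝ} (H : SecondDiffBound g δ w) (hδ : 0 ≤ δ) :
    0 ≤ w :=
  (abs_nonneg _).trans (H 0 0 le_rfl hδ (by simp) (by simp))

/-- Restriction to the `i`-th of `n` equal subintervals, rescaled to `[0,1]`. -/
theorem SecondDiffBound.comp_cell {g : ℝ → ℝ} {δ δ' w : ℝ} {n i : ℕ}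
    (H : SecondDiffBound g δ w) (hi : i < n) (hδ : δ' / n ≤ δ) :
    SecondDiffBound (fun x => g ((i + x) / n)) δ' w := by
  intro x h h0 hh hx1 hx2
  have hn : (0 : ℝ) < n := by exact_mod_cast (Nat.zero_le i).trans_lt hi
  have hi' : (i : ℝ) + 1 ≤ n := by exact_mod_cast hi
  have e1 : ((i : ℝ) + (x - h)) / n = (i + x) / n - h / n := by ring
  have e2 : ((i : ℝ) + (x + h)) / n = (i + x) / n + h / n := by ring
  have := H ((i + x) / n) (h / n) (by positivity)
    ((div_le_div_of_nonneg_right hh hn.le).trans hδ)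
    (by rw [← e1]; positivity) (by rw [← e2, div_le_one hn]; linarith)
  rwa [← e1, ← e2] at this

theorem continuousOn_comp_cell {g : ℝ → ℝ} {n i : ℕ} (hg : ContinuousOn g (Set.Icc 0 1))
    (hi : i < n) : ContinuousOn (fun x => g ((i + x) / n)) (Set.Icc 0 1) := by
  have hn : (0 : ℝ) < n := by exact_mod_cast (Nat.zero_le i).trans_lt hi
  have hi' : (i : ℝ) + 1 ≤ n := by exact_mod_cast hi
  refine hg.comp (by fun_prop) fun x hx => ⟨?_, ?_⟩
  · have := hx.1
    positivity
  · rw [div_le_one hn]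
    linarith [hx.2]

theorem integral_eq_sum_cell {g : ℝ → ℝ} {n : ℕ} (hg : ContinuousOn g (Set.Icc 0 1))
    (hn : 0 < n) :
    ∫ x in (0 : ℝ)..1, g x =
      1 / (n : ℝ) * ∑ i ∈ Finset.range n, ∫ x in (0 : ℝ)..1, g ((i + x) / n) := by
  have hn' : (0 : ℝ) < n := by exact_mod_cast hn
  have hcell : ∀ i ∈ Finset.range n, ∫ x in (0 : ℝ)..1, g ((i + x) / n) =
      n * ∫ x in ((i : ℕ) / n : ℝ)..((i + 1 : ℕ) / n : ℝ), g x := by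
    intro i _
    have := intervalIntegral.integral_comp_add_div (a := 0) (b := 1) g hn'.ne' ((i : ℝ) / n)
    simp only [smul_eq_mul, zero_div, add_zero] at this
    rw [Nat.cast_add, Nat.cast_one, add_div, ← this]
    simp only [add_div]
  rw [Finset.sum_congr rfl hcell, ← Finset.mul_sum,
    intervalIntegral.sum_integral_adjacent_intervals (a := fun i : ℕ => (i / n : ℝ))]
  · field_simp
    simp
  · intro i hi
    have hi' : (i : ℝ) + 1 ≤ n := by exact_mod_cast hi
    refine (hg.mono ?_).intervalIntegrable
    rw [Set.uIcc_of_le (by gcongr; simp)]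
    refine Set.Icc_subset_Icc (by positivity) ?_
    rw [div_le_one hn']
    exact_mod_cast hi

theorem le_of_secondDiff_le {φ : ℝ → ℝ} {δ w : ℝ} (hφ : ContinuousOn φ (Set.Icc 0 1))
    (h0 : φ 0 = 0) (h1 : φ 1 = 0) (hδ : 0 < δ) (hδ2 : δ ≤ 1 / 2) (hw : 0 ≤ w)
    (H : ∀ x h : ℝ, 0 ≤ h → h ≤ δ → 0 ≤ x - h → x + h ≤ 1 →
      2 * φ x - φ (x - h) - φ (x + h) ≤ w) {x : ℝ} (hx : x ∈ Set.Icc (0 : ℝ) 1) :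
    φ x ≤ w * (1 + x * (1 - x) / (2 * δ ^ 2)) := by
  obtain ⟨c, hc, hcδ⟩ : ∃ c : ℝ, 0 ≤ c ∧ c * (2 * δ ^ 2) = w :=
    ⟨w / (2 * δ ^ 2), by positivity, by field_simp⟩
  have hψc : ContinuousOn (fun y => φ y - c * (y * (1 - y))) (Set.Icc 0 1) :=
    hφ.sub (by fun_prop)
  obtain ⟨z, hz, hzmax⟩ := isCompact_Icc.exists_isMaxOn ⟨0, by simp⟩ hψc
  obtain ⟨M, hM⟩ : ∃ M, M = φ z - c * (z * (1 - z)) := ⟨_, rfl⟩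
  have hle : ∀ y, 0 ≤ y → y ≤ 1 → φ y - c * (y * (1 - y)) ≤ M := fun y hy0 hy1 =>
    hM ▸ hzmax ⟨hy0, hy1⟩
  -- The smallest maximiser cannot lie at distance at least `δ` from both endpoints.
  obtain ⟨p, ⟨⟨hp0, hp1⟩, hpM⟩, hpmin⟩ :=
    (isCompact_Icc.of_isClosed_subset
      (hψc.preimage_isClosed_of_isClosed isClosed_Icc (isClosed_singleton (x := M)))
      Set.inter_subset_left).exists_isLeast ⟨z, hz, hM.symm⟩
  replace hpM : φ p - c * (p * (1 - p)) = M := hpM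
  have hMw : M ≤ w := by
    rcases lt_or_ge p δ with hpl | hpl
    · have e := H p p hp0 hpl.le (by simp) (by linarith)
      have e2 := hle (p + p) (by linarith) (by linarith)
      rw [sub_self, h0] at e
      nlinarith [mul_nonneg hc (sq_nonneg p)]
    rcases lt_or_ge (1 - δ) p with hpr | hpr
    · have e := H p (1 - p) (by linarith) (by linarith) (by linarith) (by linarith)
      have e2 := hle (p - (1 - p)) (by linarith) (by linarith)
      rw [add_sub_cancel, h1] at e
      nlinarith [mul_nonneg hc (sq_nonneg (1 - p))]
    · exfalso
      have e := H p δ hδ.le le_rfl (by linarith) (by linarith)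
      have e1 := hle (p - δ) (by linarith) (by linarith)
      have e2 := hle (p + δ) (by linarith) (by linarith)
      have e3 : φ (p - δ) - c * ((p - δ) * (1 - (p - δ))) = M := by
        refine le_antisymm e1 ?_
        nlinarith
      have := hpmin ⟨⟨by linarith, by linarith⟩, e3⟩
      linarith
  have e := hle x hx.1 hx.2
  have : w * (1 + x * (1 - x) / (2 * δ ^ 2)) = w + c * (x * (1 - x)) := by
    rw [← hcδ]
    field_simp
  linarith

theorem SecondDiffBound.abs_chord_sub_le {g : ℝ → ℝ} {δ w : ℝ} (H : SecondDiffBound g δ w)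
    (hg : ContinuousOn g (Set.Icc 0 1)) (hδ : 0 < δ) (hδ2 : δ ≤ 1 / 2) {x : ℝ}
    (hx : x ∈ Set.Icc (0 : ℝ) 1) :
    |g x - ((1 - x) * g 0 + x * g 1)| ≤ w * (1 + x * (1 - x) / (2 * δ ^ 2)) := by
  have hw := H.nonneg hδ.le
  have hc : ContinuousOn (fun x => g x - ((1 - x) * g 0 + x * g 1)) (Set.Icc 0 1) :=
    hg.sub (by fun_prop)
  refine abs_le'.mpr ⟨?_, ?_⟩
  · refine le_of_secondDiff_le hc (by simp) (by simp) hδ hδ2 hw ?_ hx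
    intro y h h0 hh hy1 hy2
    have := abs_le.mp (H y h h0 hh hy1 hy2)
    linarith [this.1]
  · refine le_of_secondDiff_le hc.neg (by simp) (by simp) hδ hδ2 hw ?_ hx
    intro y h h0 hh hy1 hy2
    have := abs_le.mp (H y h h0 hh hy1 hy2)
    simp only [Pi.neg_apply]
    linarith [this.2]

theorem one_div_sqrt_le_half {a : ℝ} (ha : 6 ≤ a) : 1 / √a ≤ 1 / 2 := by
  gcongr
  exact Real.le_sqrt_of_sq_le (by linarith)

theorem abs_integral_sub_trapezoid_le {g : ℝ → ℝ} {w : ℝ} (H : SecondDiffBound g (1 / √6) w)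
    (hg : ContinuousOn g (Set.Icc 0 1)) :
    |(∫ x in (0 : ℝ)..1, g x) - (g 0 + g 1) / 2| ≤ 3 / 2 * w := by
  have hlin : ∫ x in (0 : ℝ)..1, ((1 - x) * g 0 + x * g 1) = (g 0 + g 1) / 2 := by
    have : ∀ x : ℝ, (1 - x) * g 0 + x * g 1 = g 0 + x * (g 1 - g 0) := by
      intro x; ring
    simp only [this]
    rw [intervalIntegral.integral_add (by simp)
      (by apply Continuous.intervalIntegrable; fun_prop), intervalIntegral.integral_mul_const]
    simp
    ring
  have hquad : ∫ x in (0 : ℝ)..1, w * (1 + x * (1 - x) / (2 * (1 / √6) ^ 2)) = 3 / 2 * w := by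
    have : ∀ x : ℝ, w * (1 + x * (1 - x) / (2 * (1 / √6) ^ 2)) =
        w + (x * (3 * w) - x ^ 2 * (3 * w)) := by
      intro x
      rw [div_pow, Real.sq_sqrt (by norm_num)]
      ring
    simp only [this]
    rw [intervalIntegral.integral_add (by simp)
      (by apply Continuous.intervalIntegrable; fun_prop), intervalIntegral.integral_sub
      (by apply Continuous.intervalIntegrable; fun_prop)
      (by apply Continuous.intervalIntegrable; fun_prop), intervalIntegral.integral_mul_const,
      intervalIntegral.integral_mul_const]
    simp [integral_pow]
    ring
  have hgi : IntervalIntegrable g MeasureTheory.volume 0 1 := by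
    refine ContinuousOn.intervalIntegrable ?_
    rwa [Set.uIcc_of_le zero_le_one]
  rw [← hlin, ← hquad, ← intervalIntegral.integral_sub hgi
    (by apply Continuous.intervalIntegrable; fun_prop), ← Real.norm_eq_abs]
  refine intervalIntegral.norm_integral_le_of_norm_le zero_le_one ?_
    (by apply Continuous.intervalIntegrable; fun_prop)
  filter_upwards with x hx
  exact H.abs_chord_sub_le hg (by positivity) (one_div_sqrt_le_half le_rfl)
    (Set.Ioc_subset_Icc_self hx)

theorem sum_range_cast_id (n : ℕ) : ∑ i ∈ Finset.range (n + 1), (i : ℝ) = n * (n + 1) / 2 := by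
  induction n with
  | zero => simp
  | succ k ih => rw [Finset.sum_range_succ, ih]; push_cast; ring

theorem sum_range_cast_sq (n : ℕ) :
    ∑ i ∈ Finset.range (n + 1), (i : ℝ) ^ 2 = n * (n + 1) * (2 * n + 1) / 6 := by
  induction n with
  | zero => simp
  | succ k ih => rw [Finset.sum_range_succ, ih]; push_cast; ring

theorem sum_range_trapezoid (a : ℕ → ℝ) (n : ℕ) :
    ∑ i ∈ Finset.range n, (a i + a (i + 1)) / 2 =
      ∑ i ∈ Finset.range (n + 1), a i - (a 0 + a n) / 2 := by
  induction n with
  | zero => simp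
  | succ k ih => rw [Finset.sum_range_succ, ih, Finset.sum_range_succ a (k + 1)]; ring

theorem abs_average_sub_endpoints_le {g : ℝ → ℝ} {w : ℝ} {n : ℕ} (hn : 0 < n)
    (H : SecondDiffBound g (1 / √(6 * n)) w) (hg : ContinuousOn g (Set.Icc 0 1)) :
    |1 / (n + 1 : ℝ) * ∑ i ∈ Finset.range (n + 1), g (i / n) - (g 0 + g 1) / 2| ≤
      3 / 4 * n * w := by
  have hn1 : (1 : ℝ) ≤ n := by exact_mod_cast hn
  have hn0 : (0 : ℝ) < n := by linarith
  have hw : 0 ≤ w := H.nonneg (by positivity)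
  rcases Nat.eq_or_lt_of_le hn with rfl | h2
  · simp [Finset.sum_range_succ]
    ring_nf
    simpa using hw
  have hn2 : (2 : ℝ) ≤ n := by exact_mod_cast h2
  have hchord : ∑ i ∈ Finset.range (n + 1), ((1 - (i : ℝ) / n) * g 0 + i / n * g 1) =
      (n + 1) * ((g 0 + g 1) / 2) := by
    have : ∀ i : ℕ, (1 - (i : ℝ) / n) * g 0 + i / n * g 1 = g 0 + i * ((g 1 - g 0) / n) := by
      intro i; ring
    simp only [this]
    rw [Finset.sum_add_distrib, ← Finset.sum_mul, sum_range_cast_id]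
    simp
    field_simp
    ring
  have hbound : ∑ i ∈ Finset.range (n + 1),
      w * (1 + (i / n : ℝ) * (1 - i / n) / (2 * (1 / √(6 * n)) ^ 2)) =
      w * (n + 1) * ((n + 1) / 2) := by
    have : ∀ i : ℕ, w * (1 + (i / n : ℝ) * (1 - i / n) / (2 * (1 / √(6 * n)) ^ 2)) =
        w + (i * (3 * w) - (i : ℝ) ^ 2 * (3 * w / n)) := by
      intro i
      rw [div_pow, Real.sq_sqrt (by positivity)]
      field_simp
      ring
    simp only [this]
    rw [Finset.sum_add_distrib, Finset.sum_sub_distrib, ← Finset.sum_mul, ← Finset.sum_mul,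
      sum_range_cast_id, sum_range_cast_sq]
    simp
    field_simp
    ring
  have hrw : 1 / (n + 1 : ℝ) * ∑ i ∈ Finset.range (n + 1), g (i / n) - (g 0 + g 1) / 2 =
      1 / (n + 1 : ℝ) * ∑ i ∈ Finset.range (n + 1),
        (g (i / n) - ((1 - (i : ℝ) / n) * g 0 + i / n * g 1)) := by
    rw [Finset.sum_sub_distrib, hchord]
    field_simp
  rw [hrw, abs_mul, abs_of_pos (by positivity)]
  calc _ ≤ 1 / (n + 1 : ℝ) * (w * (n + 1) * ((n + 1) / 2)) := by
        gcongr
        rw [← hbound]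
        refine (Finset.abs_sum_le_sum_abs _ _).trans (Finset.sum_le_sum fun i hi => ?_)
        have hi' : (i : ℝ) ≤ n := by exact_mod_cast Finset.mem_range_succ_iff.mp hi
        exact H.abs_chord_sub_le hg (by positivity) (one_div_sqrt_le_half (by linarith))
          ⟨by positivity, div_le_one_of_le₀ hi' hn0.le⟩
    _ = w * ((n + 1) / 2) := by field_simp
    _ ≤ 3 / 4 * n * w := by nlinarith

theorem abs_mul_sum_sub_le {m : ℕ} (hm : 0 < m) {a b : ℕ → ℝ} {C : ℝ}
    (h : ∀ i < m, |a i - b i| ≤ C) :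
    |1 / (m : ℝ) * ∑ i ∈ Finset.range m, a i - 1 / (m : ℝ) * ∑ i ∈ Finset.range m, b i| ≤ C := by
  have hm' : (0 : ℝ) < m := by exact_mod_cast hm
  rw [← mul_sub, ← Finset.sum_sub_distrib, abs_mul, abs_of_pos (by positivity),
    one_div_mul_eq_div, div_le_iff₀ hm']
  refine (Finset.abs_sum_le_sum_abs _ _).trans
    ((Finset.sum_le_sum fun i hi => h i (Finset.mem_range.mp hi)).trans ?_)
  simp [mul_comm]

theorem abs_integral_sub_average_le {g : ℝ → ℝ} {w : ℝ} {n : ℕ} (hn : 0 < n)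
    (H : SecondDiffBound g (1 / √(6 * n)) w) (hg : ContinuousOn g (Set.Icc 0 1)) :
    |(∫ x in (0 : ℝ)..1, g x) - 1 / (n + 1 : ℝ) * ∑ i ∈ Finset.range (n + 1), g (i / n)| ≤
      9 / 4 * w := by
  have hn1 : (1 : ℝ) ≤ n := by exact_mod_cast hn
  have hn0 : (0 : ℝ) < n := by linarith
  have hstep : 1 / √6 / (n : ℝ) ≤ 1 / √(6 * n) := by
    rw [div_div]
    gcongr
    rw [Real.sqrt_mul (by norm_num)]
    gcongr
    exact Real.sqrt_le_iff.mpr ⟨hn0.le, le_self_pow₀ hn1 two_ne_zero⟩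
  have htrap := abs_mul_sum_sub_le hn fun i hi =>
    abs_integral_sub_trapezoid_le (H.comp_cell hi hstep) (continuousOn_comp_cell hg hi)
  rw [← integral_eq_sum_cell hg hn] at htrap
  have hsum : ∑ i ∈ Finset.range n, (g ((i + 0) / n) + g ((i + 1) / n)) / 2 =
      ∑ i ∈ Finset.range (n + 1), g (i / n) - (g 0 + g 1) / 2 := by
    have := sum_range_trapezoid (fun i => g (i / n)) n
    simpa [hn0.ne'] using this
  rw [hsum] at htrap
  have havg := abs_average_sub_endpoints_le hn H hg
  set S := ∑ i ∈ Finset.range (n + 1), g (i / n)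
  have hdiff : 1 / (n : ℝ) * (S - (g 0 + g 1) / 2) - 1 / (n + 1 : ℝ) * S =
      1 / (n : ℝ) * (1 / (n + 1 : ℝ) * S - (g 0 + g 1) / 2) := by
    field_simp
    ring
  have hdiff_le : |1 / (n : ℝ) * (S - (g 0 + g 1) / 2) - 1 / (n + 1 : ℝ) * S| ≤ 3 / 4 * w := by
    rw [hdiff, abs_mul, abs_of_pos (by positivity), one_div_mul_eq_div, div_le_iff₀ hn0]
    linarith
  refine (abs_sub_le _ (1 / (n : ℝ) * (S - (g 0 + g 1) / 2)) _).trans ?_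
  linarith

theorem quadI_eq_average {n m : ℕ} (hn : 0 < n) (hm : 0 < m) (f : ℝ → ℝ) :
    quadI n m f = 1 / (m : ℝ) * ∑ k ∈ Finset.range m,
      (1 / (n + 1 : ℝ) * ∑ i ∈ Finset.range (n + 1), f ((k + i / n) / m)) := by
  have hn0 : (n : ℝ) ≠ 0 := by exact_mod_cast hn.ne'
  have hm0 : (m : ℝ) ≠ 0 := by exact_mod_cast hm.ne'
  have hIcc : Finset.Icc 1 m = Finset.Ico (0 + 1) (m + 1) := by
    rw [zero_add, Finset.Ico_add_one_right_eq_Icc]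
  rw [quadI, ← Finset.mul_sum, ← mul_assoc, hIcc, ← Finset.sum_Ico_add', ← Finset.range_eq_Ico]
  congr 1
  · field_simp
  · refine Finset.sum_congr rfl fun k _ => Finset.sum_congr rfl fun i _ => congrArg f ?_
    push_cast
    field_simp
    ring

theorem quadrature_error_omega2
    (n m : ℕ) (hn : 0 < n) (hm : 0 < m)
    (f : ℝ → ℝ) (hf : ContinuousOn f (Set.Icc 0 1)) :
    |(∫ x in (0 : ℝ)..1, f x) - quadI n m f| ≤
      9 / 4 * omega2 0 1 f (1 / ((m : ℝ) * Real.sqrt (6 * (n : ℝ)))) := by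
  rw [quadI_eq_average hn hm, integral_eq_sum_cell hf hm]
  refine abs_mul_sum_sub_le hm fun k hk => ?_
  refine abs_integral_sub_average_le hn ?_ (continuousOn_comp_cell hf hk)
  refine (secondDiffBound_omega2 hf _).comp_cell hk (le_of_eq ?_)
  rw [div_div, mul_comm]
end
end

section
/- If L : C[0,1] → ℝ is a positive linear functional with L(e₀) = 1 (e₀ the constant function 1), then for all f, g ∈ C[0,1], setting T(f,g) := L(f·g) - L(f)·L(g), one has |T(f,g)| ≤ (1/4)·ω̃(f; 2√(T(e₁,e₁)))·ω̃(g; 2√(T(e₁,e₁))), where T(e₁,e₁) = L(e₂) - [L(e₁)]² and eⱼ(t) = tʲ. -/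
open Set Finset

noncomputable section

/-- The unit interval `[0,1]` as a set. -/
abbrev I01 : Set ℝ := Set.Icc (0 : ℝ) 1

/-- First order modulus of continuity for a continuous function on `[0,1]`. -/
def omega1I (f : C(I01, ℝ)) (t : ℝ) : ℝ :=
  sSup {v | ∃ x y : I01, |(x : ℝ) - (y : ℝ)| ≤ t ∧ v = |f x - f y|}

/-- Least concave majorant of the first order modulus of continuity. -/
def omegaTildeI (f : C(I01, ℝ)) (t : ℝ) : ℝ :=
  if t ≤ 1 then
    sSup {v | ∃ x y : ℝ, 0 ≤ x ∧ x ≤ t ∧ t ≤ y ∧ y ≤ 1 ∧ x ≠ y ∧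
      v = ((t - x) * omega1I f y + (y - t) * omega1I f x) / (y - x)}
  else omega1I f 1

/-! ### The modulus of continuity -/

lemma abs_sub_le_two_norm (f : C(I01, ℝ)) (x y : I01) : |f x - f y| ≤ 2 * ‖f‖ := by
  have hx := f.norm_coe_le_norm x
  have hy := f.norm_coe_le_norm y
  rw [Real.norm_eq_abs] at hx hy
  have := abs_sub (f x) (f y)
  linarith

lemma omega1I_bddAbove (f : C(I01, ℝ)) (t : ℝ) :
    BddAbove {v | ∃ x y : I01, |(x : ℝ) - (y : ℝ)| ≤ t ∧ v = |f x - f y|} := by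
  refine ⟨2 * ‖f‖, ?_⟩
  rintro v ⟨x, y, -, rfl⟩
  exact abs_sub_le_two_norm f x y

lemma abs_sub_le_omega1I (f : C(I01, ℝ)) {t : ℝ} {x y : I01} (h : |(x : ℝ) - (y : ℝ)| ≤ t) :
    |f x - f y| ≤ omega1I f t :=
  le_csSup (omega1I_bddAbove f t) ⟨x, y, h, rfl⟩

lemma omega1I_nonneg (f : C(I01, ℝ)) (t : ℝ) : 0 ≤ omega1I f t := by
  apply Real.sSup_nonneg
  rintro v ⟨x, y, -, rfl⟩
  exact abs_nonneg _

lemma omega1I_le_two_norm (f : C(I01, ℝ)) (t : ℝ) : omega1I f t ≤ 2 * ‖f‖ := by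
  apply Real.sSup_le
  · rintro v ⟨x, y, -, rfl⟩
    exact abs_sub_le_two_norm f x y
  · positivity

lemma omega1I_mono (f : C(I01, ℝ)) : Monotone (omega1I f) := by
  intro s t hst
  apply Real.sSup_le
  · rintro v ⟨x, y, hxy, rfl⟩
    exact abs_sub_le_omega1I f (hxy.trans hst)
  · exact omega1I_nonneg f t

/-! ### The least concave majorant -/

lemma omegaTildeI_nonneg (f : C(I01, ℝ)) (t : ℝ) : 0 ≤ omegaTildeI f t := by
  unfold omegaTildeI
  split_ifs
  · apply Real.sSup_nonneg
    rintro v ⟨x, y, -, hxt, hty, -, -, rfl⟩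
    have := omega1I_nonneg f x
    have := omega1I_nonneg f y
    exact div_nonneg (add_nonneg (mul_nonneg (by linarith) (by assumption))
      (mul_nonneg (by linarith) (by assumption))) (by linarith)
  · exact omega1I_nonneg f 1

lemma chord_le_omegaTildeI (f : C(I01, ℝ)) {t x y : ℝ} (hx : 0 ≤ x) (hxt : x ≤ t)
    (hty : t ≤ y) (hy : y ≤ 1) (hxy : x ≠ y) :
    (t - x) * omega1I f y + (y - t) * omega1I f x ≤ omegaTildeI f t * (y - x) := by
  have hlt : x < y := lt_of_le_of_ne (hxt.trans hty) hxy
  rw [omegaTildeI, if_pos (hty.trans hy), ← div_le_iff₀ (sub_pos.2 hlt)]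
  refine le_csSup ⟨2 * ‖f‖, ?_⟩ ⟨x, y, hx, hxt, hty, hy, hxy, rfl⟩
  rintro v ⟨x, y, -, hxt, hty, -, hxy, rfl⟩
  have hlt : x < y := lt_of_le_of_ne (hxt.trans hty) hxy
  rw [div_le_iff₀ (sub_pos.2 hlt)]
  have h1 := mul_le_mul_of_nonneg_left (omega1I_le_two_norm f y) (sub_nonneg.2 hxt)
  have h2 := mul_le_mul_of_nonneg_left (omega1I_le_two_norm f x) (sub_nonneg.2 hty)
  linarith

lemma omega1I_le_omegaTildeI (f : C(I01, ℝ)) {t : ℝ} (ht : 0 < t) (ht1 : t ≤ 1) :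
    omega1I f t ≤ omegaTildeI f t := by
  have h := chord_le_omegaTildeI f le_rfl ht.le le_rfl ht1 ht.ne
  simp only [sub_zero, sub_self, zero_mul, add_zero] at h
  rw [mul_comm] at h
  exact le_of_mul_le_mul_right h ht

/-- A supporting line of the least concave majorant at an interior point. -/
lemma exists_supporting_line_s16 (f : C(I01, ℝ)) {t : ℝ} (ht : 0 < t) (ht1 : t ≤ 1) :
    ∃ a b : ℝ, 0 ≤ a ∧ 0 ≤ b ∧ a + b * t = omegaTildeI f t ∧
      ∀ s, 0 ≤ s → s ≤ 1 → omega1I f s ≤ a + b * s := by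
  set M := omegaTildeI f t with hM
  have hMt : omega1I f t ≤ M := omega1I_le_omegaTildeI f ht ht1
  set S : Set ℝ := insert 0 {v | ∃ y, t < y ∧ y ≤ 1 ∧ v = (omega1I f y - M) / (y - t)} with hS
  have hub : ∀ x, 0 ≤ x → x < t → ∀ v ∈ S, v ≤ (M - omega1I f x) / (t - x) := by
    intro x hx hxt v hv
    rw [le_div_iff₀ (sub_pos.2 hxt)]
    rcases hv with rfl | ⟨y, hty, hy, rfl⟩
    · have := omega1I_mono f hxt.le
      linarith
    · rw [div_mul_eq_mul_div, div_le_iff₀ (sub_pos.2 hty)]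
      have := chord_le_omegaTildeI f hx hxt.le hty.le hy (hxt.trans hty).ne
      rw [← hM] at this
      nlinarith
  have hbdd : BddAbove S := ⟨_, hub 0 le_rfl ht⟩
  have hne : S.Nonempty := ⟨0, Set.mem_insert _ _⟩
  have hleft : ∀ x, 0 ≤ x → x < t → omega1I f x ≤ M - sSup S * t + sSup S * x := by
    intro x hx hxt
    have := csSup_le hne (hub x hx hxt)
    rw [le_div_iff₀ (sub_pos.2 hxt)] at this
    linarith
  refine ⟨M - sSup S * t, sSup S, ?_, le_csSup hbdd (Set.mem_insert _ _), by ring, ?_⟩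
  · have := hleft 0 le_rfl ht
    have := omega1I_nonneg f 0
    linarith
  · intro s hs hs1
    rcases lt_trichotomy s t with h | rfl | h
    · exact hleft s hs h
    · linarith
    · have := le_csSup hbdd (Set.mem_insert_of_mem 0 ⟨s, h, hs1, rfl⟩)
      rw [div_le_iff₀ (sub_pos.2 h)] at this
      linarith

lemma exists_abs_sub_le_of_omega1I_le (f : C(I01, ℝ)) {a b : ℝ} (hb : 0 ≤ b)
    (h : ∀ s, 0 ≤ s → s ≤ 1 → omega1I f s ≤ a + b * s) (m : ℝ) :
    ∃ c, ∀ x : I01, |f x - c| ≤ a / 2 + b * |(x : ℝ) - m| := by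
  have key : ∀ x y : I01, f x - a / 2 - b * |(x : ℝ) - m| ≤ f y + a / 2 + b * |(y : ℝ) - m| := by
    intro x y
    have h1 : |(x : ℝ) - y| ≤ 1 := by
      rw [abs_le]
      constructor <;> linarith [x.2.1, x.2.2, y.2.1, y.2.2]
    have h2 := (abs_sub_le_omega1I f le_rfl).trans (h |(x : ℝ) - y| (abs_nonneg _) h1)
    have h3 := abs_sub_le (x : ℝ) m y
    rw [abs_sub_comm m] at h3
    have h4 := mul_le_mul_of_nonneg_left h3 hb
    linarith [le_abs_self (f x - f y)]
  have : Nonempty I01 := ⟨⟨0, by simp⟩⟩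
  refine ⟨⨆ x : I01, (f x - a / 2 - b * |(x : ℝ) - m|), fun y => ?_⟩
  have h1 := ciSup_le (fun x => key x y)
  have h2 := le_ciSup (f := fun x : I01 => f x - a / 2 - b * |(x : ℝ) - m|)
    ⟨_, by rintro _ ⟨x, rfl⟩; exact key x y⟩ y
  rw [abs_le]
  constructor <;> linarith

lemma exists_abs_sub_le_add_mul (f : C(I01, ℝ)) (m : I01) {ε : ℝ} (hε : 0 < ε) :
    ∃ b, 0 ≤ b ∧ ∀ x : I01, |f x - f m| ≤ ε + b * |(x : ℝ) - m| := by
  obtain ⟨δ, hδ, h⟩ := Metric.continuousAt_iff.1 f.continuous.continuousAt ε hε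
  refine ⟨2 * ‖f‖ / δ, by positivity, fun x => ?_⟩
  by_cases hx : dist x m < δ
  · have h1 := h hx
    rw [Real.dist_eq] at h1
    have : 0 ≤ 2 * ‖f‖ / δ * |(x : ℝ) - m| := by positivity
    linarith
  · rw [Subtype.dist_eq, Real.dist_eq, not_lt] at hx
    have h1 := abs_sub_le_two_norm f x m
    have h2 : 2 * ‖f‖ / δ * δ ≤ 2 * ‖f‖ / δ * |(x : ℝ) - m| :=
      mul_le_mul_of_nonneg_left hx (by positivity)
    rw [div_mul_cancel₀ _ hδ.ne'] at h2
    linarith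

/-! ### Positive normalized functionals -/

section PositiveFunctional

variable {L : C(I01, ℝ) →ₗ[ℝ] ℝ}

lemma map_le_of_le (hpos : ∀ f : C(I01, ℝ), (∀ x, 0 ≤ f x) → 0 ≤ L f) {f g : C(I01, ℝ)}
    (h : ∀ x, f x ≤ g x) : L f ≤ L g := by
  have := hpos (g - f) (fun x => by simpa using h x)
  rw [map_sub] at this
  linarith

lemma map_quadratic (hone : L (ContinuousMap.const I01 1) = 1) (f : C(I01, ℝ)) (p q r : ℝ) :
    L (p • (f * f) + q • f + ContinuousMap.const I01 r) = p * L (f * f) + q * L f + r := by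
  have : ContinuousMap.const I01 r = r • ContinuousMap.const I01 (1 : ℝ) := by
    ext x; simp
  rw [this, map_add, map_add, map_smul, map_smul, map_smul, hone]
  simp

lemma sq_map_le_map_mul_self (hpos : ∀ f : C(I01, ℝ), (∀ x, 0 ≤ f x) → 0 ≤ L f)
    (hone : L (ContinuousMap.const I01 1) = 1) (f : C(I01, ℝ)) : (L f) ^ 2 ≤ L (f * f) := by
  have h := hpos ((1 : ℝ) • (f * f) + (-2 * L f) • f + ContinuousMap.const I01 ((L f) ^ 2))
    (fun x => by simp; nlinarith [sq_nonneg (f x - L f)])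
  rw [map_quadratic hone] at h
  linarith

lemma abs_covariance_le_s16 (hpos : ∀ f : C(I01, ℝ), (∀ x, 0 ≤ f x) → 0 ≤ L f)
    (hone : L (ContinuousMap.const I01 1) = 1) (f g : C(I01, ℝ)) {A B : ℝ}
    (hA : 0 ≤ A) (hB : 0 ≤ B) (hf : L (f * f) - (L f) ^ 2 ≤ A ^ 2)
    (hg : L (g * g) - (L g) ^ 2 ≤ B ^ 2) : |L (f * g) - L f * L g| ≤ A * B := by
  have hquad : ∀ s : ℝ, 0 ≤ (L (g * g) - (L g) ^ 2) * (s * s) +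
      2 * (L (f * g) - L f * L g) * s + (L (f * f) - (L f) ^ 2) := by
    intro s
    have h := sq_map_le_map_mul_self hpos hone (f + s • g)
    have e : (f + s • g) * (f + s • g) = f * f + (2 * s) • (f * g) + (s * s) • (g * g) := by
      ext x; simp; ring
    rw [e] at h
    simp only [map_add, map_smul, smul_eq_mul] at h
    nlinarith
  have hd := discrim_le_zero hquad
  rw [discrim] at hd
  have hf0 := sq_map_le_map_mul_self hpos hone f
  have hprod : (L (g * g) - (L g) ^ 2) * (L (f * f) - (L f) ^ 2) ≤ B ^ 2 * A ^ 2 :=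
    mul_le_mul hg hf (by linarith) (by positivity)
  apply abs_le_of_sq_le_sq _ (mul_nonneg hA hB)
  nlinarith

lemma variance_le_sq (hpos : ∀ f : C(I01, ℝ), (∀ x, 0 ≤ f x) → 0 ≤ L f)
    (hone : L (ContinuousMap.const I01 1) = 1) (f e : C(I01, ℝ)) {α β c : ℝ}
    (hα : 0 ≤ α) (hβ : 0 ≤ β) (h : ∀ x, |f x - c| ≤ α + β * |e x - L e|) :
    L (f * f) - (L f) ^ 2 ≤ (α + β * √(L (e * e) - (L e) ^ 2)) ^ 2 := by
  set σ := √(L (e * e) - (L e) ^ 2) with hσ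
  have hσ2 : σ ^ 2 = L (e * e) - (L e) ^ 2 :=
    Real.sq_sqrt (sub_nonneg.2 (sq_map_le_map_mul_self hpos hone e))
  set u : C(I01, ℝ) := ⟨fun x => |e x - L e|, by fun_prop⟩ with hu
  have huu : L (u * u) = σ ^ 2 := by
    have : u * u = (1 : ℝ) • (e * e) + (-2 * L e) • e + ContinuousMap.const I01 ((L e) ^ 2) := by
      ext x; simp [hu]; ring
    rw [this, map_quadratic hone, hσ2]
    ring
  have hLu : L u ≤ σ := by
    have := sq_map_le_map_mul_self hpos hone u
    rw [huu] at this
    exact le_trans (le_abs_self _) (abs_le_of_sq_le_sq this (Real.sqrt_nonneg _))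
  have hle := map_le_of_le hpos
    (f := (1 : ℝ) • (f * f) + (-2 * c) • f + ContinuousMap.const I01 (c ^ 2))
    (g := (β ^ 2) • (u * u) + (2 * α * β) • u + ContinuousMap.const I01 (α ^ 2)) (fun x => by
      have h1 := pow_le_pow_left₀ (abs_nonneg _) (h x) 2
      rw [sq_abs] at h1
      simp only [ContinuousMap.add_apply, ContinuousMap.smul_apply, ContinuousMap.mul_apply,
        ContinuousMap.const_apply, smul_eq_mul, hu, ContinuousMap.coe_mk]
      nlinarith)
  rw [map_quadratic hone, map_quadratic hone, huu] at hle
  have := mul_le_mul_of_nonneg_left hLu (by positivity : 0 ≤ 2 * α * β)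
  nlinarith [sq_nonneg (L f - c)]

lemma variance_le_omegaTildeI (hpos : ∀ f : C(I01, ℝ), (∀ x, 0 ≤ f x) → 0 ≤ L f)
    (hone : L (ContinuousMap.const I01 1) = 1) (f e : C(I01, ℝ)) (he : ∀ x : I01, e x = x) :
    L (f * f) - (L f) ^ 2 ≤ (omegaTildeI f (2 * √(L (e * e) - (L e) ^ 2)) / 2) ^ 2 := by
  have hm0 : 0 ≤ L e := hpos e (fun x => by rw [he]; exact x.2.1)
  have hm1 : L e ≤ 1 := by
    rw [← hone]
    exact map_le_of_le hpos (fun x => by rw [he]; exact x.2.2)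
  have hee : L (e * e) ≤ L e := map_le_of_le hpos (fun x => by
    rw [ContinuousMap.mul_apply, he]
    nlinarith [x.2.1, x.2.2])
  have hσ1 : 2 * √(L (e * e) - (L e) ^ 2) ≤ 1 := by
    have : √(L (e * e) - (L e) ^ 2) ≤ 1 / 2 :=
      Real.sqrt_le_iff.2 ⟨by norm_num, by nlinarith [sq_nonneg (L e - 1 / 2)]⟩
    linarith
  have hvar := fun {α β c : ℝ} => variance_le_sq (α := α) (β := β) (c := c) hpos hone f e
  have hσ0 := Real.sqrt_nonneg (L (e * e) - (L e) ^ 2)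
  generalize √(L (e * e) - (L e) ^ 2) = σ at hσ0 hσ1 hvar ⊢
  rcases hσ0.lt_or_eq with hσ | rfl
  · obtain ⟨a, b, ha, hb, hab, hs⟩ := exists_supporting_line_s16 f (t := 2 * σ) (by linarith) hσ1
    obtain ⟨c, hc⟩ := exists_abs_sub_le_of_omega1I_le f hb hs (L e)
    have h := hvar (α := a / 2) (by positivity) hb (fun x => by rw [he]; exact hc x)
    rw [← hab]
    convert h using 2
    ring
  · have hzero : L (f * f) - (L f) ^ 2 ≤ 0 := by
      apply le_of_forall_pos_le_add
      intro η hη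
      obtain ⟨b, hb, hc⟩ := exists_abs_sub_le_add_mul f ⟨L e, hm0, hm1⟩ (Real.sqrt_pos.2 hη)
      have h := hvar (Real.sqrt_nonneg η) hb (fun x => by rw [he]; exact hc x)
      rwa [mul_zero, add_zero, Real.sq_sqrt hη.le, ← zero_add η] at h
    exact hzero.trans (sq_nonneg _)

end PositiveFunctional

theorem gruss_positive_functional
    (L : C(I01, ℝ) →ₗ[ℝ] ℝ)
    (hpos : ∀ f : C(I01, ℝ), (∀ x, 0 ≤ f x) → 0 ≤ L f)
    (hone : L (ContinuousMap.const I01 1) = 1)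
    (f g : C(I01, ℝ)) :
    |L (f * g) - L f * L g| ≤
      1 / 4 *
        omegaTildeI f (2 * Real.sqrt
          (L (ContinuousMap.mk (fun t : I01 => ((t : ℝ)) ^ 2) (by fun_prop)) -
            (L (ContinuousMap.mk (fun t : I01 => ((t : ℝ))) (by fun_prop))) ^ 2)) *
        omegaTildeI g (2 * Real.sqrt
          (L (ContinuousMap.mk (fun t : I01 => ((t : ℝ)) ^ 2) (by fun_prop)) -
            (L (ContinuousMap.mk (fun t : I01 => ((t : ℝ))) (by fun_prop))) ^ 2)) := by
  have e2 : (ContinuousMap.mk (fun t : I01 => ((t : ℝ)) ^ 2) (by fun_prop) : C(I01, ℝ)) =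
      ContinuousMap.mk (fun t : I01 => ((t : ℝ))) (by fun_prop) *
        ContinuousMap.mk (fun t : I01 => ((t : ℝ))) (by fun_prop) := by
    ext x
    simp [sq]
  rw [e2]
  have h := abs_covariance_le_s16 hpos hone f g
    (div_nonneg (omegaTildeI_nonneg f _) zero_le_two)
    (div_nonneg (omegaTildeI_nonneg g _) zero_le_two)
    (variance_le_omegaTildeI hpos hone f (ContinuousMap.mk (fun t : I01 => ((t : ℝ)))
      (by fun_prop)) (fun _ => rfl))
    (variance_le_omegaTildeI hpos hone g (ContinuousMap.mk (fun t : I01 => ((t : ℝ)))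
      (by fun_prop)) (fun _ => rfl))
  linarith
end
end
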